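/- arXiv:2201.09197 — 3 statements merged into one kernel-verified Lean document; each statement's English description precedes it below -/
import Mathlib

section
/- Let 𝒳 ∈ ℝ^{n1×n2×n3} be a third order real tensor. Then for i ∈ {1, 2}, rank_t(𝒳) ≤ rank(X_{(i)}) ≤ n3 · rank_t(𝒳), where X_{(1)} ∈ ℝ^{n1×n2n3} and X_{(2)} ∈ ℝ^{n2×n1n3} are the mode-1 and mode-2 unfoldings of 𝒳. -/
/-- The `k`-th Fourier slice of a third order real tensor `A ∈ ℝ^{n1×n2×n3}`:
`Ā^{(k)}_{ij} = Σ_{l=1}^{n3} ω^{(l−1)(k−1)} A_{ijl}` with `ω = exp(−2π i / n3)`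
(0-indexed here, so the exponent is `l·k`). -/
noncomputable def fourierSlice {n1 n2 n3 : ℕ} (A : Fin n1 → Fin n2 → Fin n3 → ℝ)
    (k : Fin n3) : Matrix (Fin n1) (Fin n2) ℂ :=
  Matrix.of fun i j =>
    ∑ l : Fin n3,
      Complex.exp (-(2 * (Real.pi : ℂ) * Complex.I) / (n3 : ℂ)) ^ ((l : ℕ) * (k : ℕ)) *
        (A i j l : ℂ)

/-- The tubal rank of a third order real tensor: `rank_t(A) = max_k rank(Ā^{(k)})`. -/
noncomputable def tubalRank {n1 n2 n3 : ℕ} (A : Fin n1 → Fin n2 → Fin n3 → ℝ) : ℕ :=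
  Finset.univ.sup fun k : Fin n3 => (fourierSlice A k).rank

/-- The column index `j + (k−1)·a` (1-indexed), i.e. `k·a + j` (0-indexed). -/
def colIdx {a b : ℕ} (j : Fin a) (k : Fin b) : Fin (a * b) :=
  ⟨(k : ℕ) * a + (j : ℕ), by
    have hj := j.isLt
    have hk : (k : ℕ) + 1 ≤ b := k.isLt
    have h1 : ((k : ℕ) + 1) * a ≤ b * a := Nat.mul_le_mul_right _ hk
    have h2 : ((k : ℕ) + 1) * a = (k : ℕ) * a + a := Nat.succ_mul _ _
    have h3 : b * a = a * b := Nat.mul_comm _ _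
    omega⟩

namespace Matrix

/-- A matrix of rank `r` over a field factors through `r`-dimensional space, and the identity of
that space factors through it. -/
theorem exists_rank_factorization {K m n : Type*} [Field K] [Fintype m] [Fintype n]
    [DecidableEq m] [DecidableEq n] (A : Matrix m n K) :
    ∃ (B : Matrix m (Fin A.rank) K) (C : Matrix (Fin A.rank) n K)
      (P : Matrix (Fin A.rank) m K) (Q : Matrix n (Fin A.rank) K),
      A = B * C ∧ P * A * Q = 1 := by
  let f : (n → K) →ₗ[K] (m → K) := toLin' A
  have hf : Module.finrank K (LinearMap.range f) = A.rank := rfl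
  let e : LinearMap.range f ≃ₗ[K] (Fin A.rank → K) :=
    LinearEquiv.ofFinrankEq _ _ (by rw [hf, Module.finrank_fin_fun])
  obtain ⟨p, hp⟩ := (LinearMap.range f).subtype.exists_leftInverse_of_injective
    (Submodule.ker_subtype _)
  obtain ⟨s, hs⟩ := f.rangeRestrict.exists_rightInverse_of_surjective f.range_rangeRestrict
  have hp' (x) : p ((LinearMap.range f).subtype x) = x := LinearMap.congr_fun hp x
  have hs' (x) : f.rangeRestrict (s x) = x := LinearMap.congr_fun hs x
  refine ⟨LinearMap.toMatrix' ((LinearMap.range f).subtype ∘ₗ e.symm.toLinearMap),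
    LinearMap.toMatrix' (e.toLinearMap ∘ₗ f.rangeRestrict),
    LinearMap.toMatrix' (e.toLinearMap ∘ₗ p),
    LinearMap.toMatrix' (s ∘ₗ e.symm.toLinearMap), ?_, ?_⟩
  · rw [← LinearMap.toMatrix'_comp]
    refine (LinearMap.toMatrix'_toLin' A).symm.trans (congrArg _ (LinearMap.ext fun x => ?_))
    simp [f]
  · have hA : LinearMap.toMatrix' f = A := LinearMap.toMatrix'_toLin' A
    refine Eq.trans (congrArg (fun M => _ * M * _) hA.symm) ?_
    rw [← LinearMap.toMatrix'_comp, ← LinearMap.toMatrix'_comp, ← LinearMap.toMatrix'_id]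
    congr 1
    refine LinearMap.ext fun x => ?_
    have h : f (s (e.symm x)) = (LinearMap.range f).subtype (e.symm x) := by
      conv_rhs => rw [← hs' (e.symm x)]
      rfl
    change e (p (f (s (e.symm x)))) = x
    rw [h, hp', e.apply_symm_apply]

/-- The rank of a matrix is invariant under field extension. -/
theorem rank_map_of_field {K L m n : Type*} [Field K] [Field L] [Fintype m] [Fintype n]
    (φ : K →+* L) (A : Matrix m n K) : (A.map φ).rank = A.rank := by
  classical
  obtain ⟨B, C, P, Q, hBC, hPQ⟩ := A.exists_rank_factorization
  apply le_antisymm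
  · have h : A.map φ = B.map φ * C.map φ := by rw [← Matrix.map_mul, ← hBC]
    rw [h]
    exact (rank_mul_le_left _ _).trans ((rank_le_card_width _).trans_eq (Fintype.card_fin _))
  · have h : P.map φ * A.map φ * Q.map φ = 1 := by
      rw [← Matrix.map_mul, ← Matrix.map_mul, hPQ, Matrix.map_one _ φ.map_zero φ.map_one]
    calc A.rank = (P.map φ * A.map φ * Q.map φ).rank := by rw [h, rank_one, Fintype.card_fin]
      _ ≤ (P.map φ * A.map φ).rank := rank_mul_le_left _ _
      _ ≤ (A.map φ).rank := rank_mul_le_right _ _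

theorem rank_add_le {K m n : Type*} [Field K] [Fintype m] [Fintype n] (A B : Matrix m n K) :
    (A + B).rank ≤ A.rank + B.rank := by
  have h : LinearMap.range (A + B).mulVecLin ≤
      LinearMap.range A.mulVecLin ⊔ LinearMap.range B.mulVecLin := by
    rintro _ ⟨x, rfl⟩
    rw [mulVecLin_add]
    exact Submodule.add_mem_sup ⟨x, rfl⟩ ⟨x, rfl⟩
  exact (Submodule.finrank_mono h).trans (Submodule.finrank_add_le_finrank_add_finrank _ _)

theorem rank_sum_le {K m n ι : Type*} [Field K] [Fintype m] [Fintype n] (s : Finset ι)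
    (A : ι → Matrix m n K) : (∑ i ∈ s, A i).rank ≤ ∑ i ∈ s, (A i).rank :=
  Finset.le_sum_of_subadditive _ rank_zero.le rank_add_le s A

end Matrix

theorem colIdx_bijective (a b : ℕ) :
    Function.Bijective fun p : Fin a × Fin b => colIdx p.1 p.2 := by
  have h : (fun p : Fin a × Fin b => colIdx p.1 p.2) =
      ((Equiv.prodComm _ _).trans (finProdFinEquiv.trans (finCongr (Nat.mul_comm b a)))) := by
    funext p
    ext
    simp [colIdx, finProdFinEquiv, Nat.mul_comm, Nat.add_comm]
  rw [h]
  exact Equiv.bijective _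

/-- The discrete Fourier transform matrix with entries `ω ^ (l * k)`, `ω = exp (-2πi / n)`. -/
noncomputable def dftMatrix (n : ℕ) : Matrix (Fin n) (Fin n) ℂ :=
  Matrix.vandermonde fun l : Fin n =>
    Complex.exp (-(2 * (Real.pi : ℂ) * Complex.I) / (n : ℂ)) ^ (l : ℕ)

theorem isUnit_det_dftMatrix (n : ℕ) : IsUnit (dftMatrix n).det := by
  rcases Nat.eq_zero_or_pos n with rfl | hn
  · simp
  · rw [isUnit_iff_ne_zero, dftMatrix, Matrix.det_vandermonde_ne_zero_iff]
    have h : IsPrimitiveRoot (Complex.exp (-(2 * (Real.pi : ℂ) * Complex.I) / (n : ℂ))) n := by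
      rw [neg_div, Complex.exp_neg]
      exact (Complex.isPrimitiveRoot_exp n hn.ne').inv
    exact fun i j hij => Fin.ext (h.pow_inj i.isLt j.isLt hij)

theorem fourierSlice_eq_sum_dftMatrix {n1 n2 n3 : ℕ} (T : Fin n1 → Fin n2 → Fin n3 → ℝ)
    (k : Fin n3) (i : Fin n1) (j : Fin n2) :
    fourierSlice T k i j = ∑ l, (T i j l : ℂ) * dftMatrix n3 l k := by
  rw [fourierSlice, Matrix.of_apply]
  refine Finset.sum_congr rfl fun l _ => ?_
  rw [dftMatrix, Matrix.vandermonde_apply, pow_mul, mul_comm]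

theorem sum_fourierSlice_mul_dftMatrix_inv {n1 n2 n3 : ℕ} (T : Fin n1 → Fin n2 → Fin n3 → ℝ)
    (i : Fin n1) (j : Fin n2) (l : Fin n3) :
    ∑ k, fourierSlice T k i j * (dftMatrix n3)⁻¹ k l = (T i j l : ℂ) := by
  have h : (fun k => fourierSlice T k i j) =
      Matrix.vecMul (fun l => (T i j l : ℂ)) (dftMatrix n3) := by
    funext k
    exact fourierSlice_eq_sum_dftMatrix T k i j
  change Matrix.vecMul (fun k => fourierSlice T k i j) (dftMatrix n3)⁻¹ l = _
  rw [h, Matrix.vecMul_vecMul, Matrix.mul_nonsing_inv _ (isUnit_det_dftMatrix n3),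
    Matrix.vecMul_one]

/-- The mode-1 unfolding, complexified, with columns indexed by pairs. -/
def complexUnfolding {n1 n2 n3 : ℕ} (T : Fin n1 → Fin n2 → Fin n3 → ℝ) :
    Matrix (Fin n1) (Fin n2 × Fin n3) ℂ :=
  Matrix.of fun i p => (T i p.1 p.2 : ℂ)

theorem rank_eq_rank_complexUnfolding {n1 n2 n3 : ℕ} (T : Fin n1 → Fin n2 → Fin n3 → ℝ)
    (X : Matrix (Fin n1) (Fin (n2 * n3)) ℝ)
    (hX : ∀ i1 i2 i3, X i1 (colIdx i2 i3) = T i1 i2 i3) :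
    X.rank = (complexUnfolding T).rank := by
  have h : complexUnfolding T = (X.map Complex.ofRealHom).submatrix (Equiv.refl _)
      (Equiv.ofBijective _ (colIdx_bijective n2 n3)) := by
    ext i p
    simp [complexUnfolding, hX]
  rw [h, Matrix.rank_submatrix, Matrix.rank_map_of_field]

theorem rank_fourierSlice_le {n1 n2 n3 : ℕ} (T : Fin n1 → Fin n2 → Fin n3 → ℝ) (k : Fin n3) :
    (fourierSlice T k).rank ≤ (complexUnfolding T).rank := by
  have h : fourierSlice T k = complexUnfolding T *
      (Matrix.of fun p j => if p.1 = j then dftMatrix n3 p.2 k else 0 :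
        Matrix (Fin n2 × Fin n3) (Fin n2) ℂ) := by
    ext i j
    rw [fourierSlice_eq_sum_dftMatrix, Matrix.mul_apply, Fintype.sum_prod_type_right]
    simp [complexUnfolding]
  rw [h]
  exact Matrix.rank_mul_le_left _ _

theorem rank_complexUnfolding_le {n1 n2 n3 : ℕ} (T : Fin n1 → Fin n2 → Fin n3 → ℝ) :
    (complexUnfolding T).rank ≤ n3 * tubalRank T := by
  have h : complexUnfolding T = ∑ k, fourierSlice T k *
      (Matrix.of fun j p => if j = p.1 then (dftMatrix n3)⁻¹ k p.2 else 0 :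
        Matrix (Fin n2) (Fin n2 × Fin n3) ℂ) := by
    ext i p
    rw [Matrix.sum_apply]
    simp only [Matrix.mul_apply, Matrix.of_apply, mul_ite, mul_zero, Finset.sum_ite_eq',
      Finset.mem_univ, if_true]
    exact (sum_fourierSlice_mul_dftMatrix_inv T i p.1 p.2).symm
  rw [h]
  refine (Matrix.rank_sum_le _ _).trans ((Finset.sum_le_card_nsmul _ _ (tubalRank T)
    fun k hk => ?_).trans_eq (by simp))
  exact (Matrix.rank_mul_le_left _ _).trans
    (Finset.le_sup (f := fun k => (fourierSlice T k).rank) hk)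

theorem tubalRank_bounds_of_unfolding {n1 n2 n3 : ℕ} (T : Fin n1 → Fin n2 → Fin n3 → ℝ)
    (X : Matrix (Fin n1) (Fin (n2 * n3)) ℝ)
    (hX : ∀ i1 i2 i3, X i1 (colIdx i2 i3) = T i1 i2 i3) :
    tubalRank T ≤ X.rank ∧ X.rank ≤ n3 * tubalRank T := by
  rw [rank_eq_rank_complexUnfolding T X hX]
  exact ⟨Finset.sup_le fun k _ => rank_fourierSlice_le T k, rank_complexUnfolding_le T⟩

theorem tubalRank_swap {n1 n2 n3 : ℕ} (T : Fin n1 → Fin n2 → Fin n3 → ℝ) :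
    tubalRank (fun j i => T i j) = tubalRank T := by
  have h (k : Fin n3) : fourierSlice (fun j i => T i j) k = (fourierSlice T k).transpose := rfl
  simp only [tubalRank, h, Matrix.rank_transpose]


/-- for a tensor `𝒳 ∈ ℝ^{n1×n2×n3}` with mode-1 unfolding
`X_{(1)} ∈ ℝ^{n1×n2n3}` (entries `X_{(1)}(i1, i2+(i3−1)n2) = 𝒳(i1,i2,i3)`) and mode-2
unfolding `X_{(2)} ∈ ℝ^{n2×n1n3}` (entries `X_{(2)}(i2, i1+(i3−1)n1) = 𝒳(i1,i2,i3)`),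
one has `rank_t(𝒳) ≤ rank(X_{(i)}) ≤ n3 · rank_t(𝒳)` for `i ∈ {1,2}`. -/
theorem tubalRank_unfold12_bounds (n1 n2 n3 : ℕ)
    (T : Fin n1 → Fin n2 → Fin n3 → ℝ)
    (X1 : Matrix (Fin n1) (Fin (n2 * n3)) ℝ)
    (hX1 : ∀ (i1 : Fin n1) (i2 : Fin n2) (i3 : Fin n3),
      X1 i1 (colIdx i2 i3) = T i1 i2 i3)
    (X2 : Matrix (Fin n2) (Fin (n1 * n3)) ℝ)
    (hX2 : ∀ (i1 : Fin n1) (i2 : Fin n2) (i3 : Fin n3),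
      X2 i2 (colIdx i1 i3) = T i1 i2 i3) :
    (tubalRank T ≤ X1.rank ∧ X1.rank ≤ n3 * tubalRank T) ∧
      (tubalRank T ≤ X2.rank ∧ X2.rank ≤ n3 * tubalRank T) := by
  refine ⟨tubalRank_bounds_of_unfolding T X1 hX1, ?_⟩
  rw [← tubalRank_swap]
  exact tubalRank_bounds_of_unfolding _ X2 fun i2 i1 i3 => hX2 i1 i2 i3
end

section
/- Let 𝒳 ∈ ℝ^{n1×n2×n3}, let p, q be positive integers with pq = n1n2, and let 𝒳̃ ∈ ℝ^{n3×p×q} be the tensor obtained by reshaping the mode-3 unfolding X_{(3)}, i.e., 𝒳̃(a, s, t) = X_{(3)}(a, (t−1)p + s). Let 𝒳_{(23)} ∈ ℝ^{n2×n3×n1} be the permuted tensor with 𝒳_{(23)}(j, k, i) = 𝒳(i, j, k). Then rank_t(𝒳̃) ≤ n1 · rank_t(𝒳_{(23)}) and rank_t(𝒳_{(23)}) ≤ q · rank_t(𝒳̃). -/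
/-- The span over `ℂ` of the mode-1 fibres `A(:, j, l)`, i.e. the column space of the mode-1
unfolding of `A`. -/
def fibreSpan {a b c : ℕ} (A : Fin a → Fin b → Fin c → ℝ) : Submodule ℂ (Fin a → ℂ) :=
  Submodule.span ℂ (Set.range fun x : Fin b × Fin c => fun i => (A i x.1 x.2 : ℂ))

/-- The matrix `ω^{kl}` of the discrete Fourier transform, with `ω = exp(−2π i / n)`. -/
noncomputable def fourierMatrix (n : ℕ) : Matrix (Fin n) (Fin n) ℂ :=
  Matrix.vandermonde fun k : Fin n =>
    Complex.exp (-(2 * (Real.pi : ℂ) * Complex.I) / (n : ℂ)) ^ (k : ℕ)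

theorem isUnit_det_fourierMatrix (n : ℕ) : IsUnit (fourierMatrix n).det := by
  rw [isUnit_iff_ne_zero, fourierMatrix, Matrix.det_vandermonde_ne_zero_iff]
  intro k l hkl
  have hn : n ≠ 0 := by have := k.isLt; omega
  have hprim := (Complex.isPrimitiveRoot_exp n hn).inv
  rw [← Complex.exp_neg, ← neg_div] at hprim
  exact Fin.ext (hprim.pow_inj k.isLt l.isLt hkl)

theorem fourierSlice_apply {a b c : ℕ} (A : Fin a → Fin b → Fin c → ℝ)
    (k : Fin c) (i : Fin a) (j : Fin b) :
    fourierSlice A k i j = ∑ l, fourierMatrix c k l * (A i j l : ℂ) := by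
  simp only [fourierSlice, fourierMatrix, Matrix.of_apply, Matrix.vandermonde_apply, ← pow_mul]
  exact Finset.sum_congr rfl fun l _ => by rw [mul_comm (l : ℕ)]

theorem fourierInversion {a b c : ℕ} (A : Fin a → Fin b → Fin c → ℝ)
    (i : Fin a) (j : Fin b) (l : Fin c) :
    (A i j l : ℂ) = ∑ k, (fourierMatrix c)⁻¹ l k * fourierSlice A k i j := by
  have h : (fun k => fourierSlice A k i j) =
      (fourierMatrix c).mulVec fun l => (A i j l : ℂ) :=
    funext fun k => fourierSlice_apply A k i j
  change _ = (fourierMatrix c)⁻¹.mulVec (fun k => fourierSlice A k i j) l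
  rw [h, Matrix.mulVec_mulVec, Matrix.nonsing_inv_mul _ (isUnit_det_fourierMatrix c),
    Matrix.one_mulVec]

theorem tubalRank_le_finrank_fibreSpan {a b c : ℕ} (A : Fin a → Fin b → Fin c → ℝ) :
    tubalRank A ≤ Module.finrank ℂ (fibreSpan A) := by
  refine Finset.sup_le fun k _ => ?_
  rw [Matrix.rank_eq_finrank_span_cols]
  refine Submodule.finrank_mono (Submodule.span_le.2 ?_)
  rintro _ ⟨j, rfl⟩
  have h : (fourierSlice A k).col j =
      ∑ l, fourierMatrix c k l • fun i => (A i j l : ℂ) := by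
    ext i
    simp [fourierSlice_apply]
  rw [h]
  exact Submodule.sum_mem _ fun l _ =>
    Submodule.smul_mem _ _ (Submodule.subset_span ⟨(j, l), rfl⟩)

theorem finrank_finset_sup_le_sum {ι K V : Type*} [DivisionRing K] [AddCommGroup V] [Module K V]
    [FiniteDimensional K V] (s : Finset ι) (W : ι → Submodule K V) :
    Module.finrank K (s.sup W : Submodule K V) ≤ ∑ i ∈ s, Module.finrank K (W i) := by
  classical
  induction s using Finset.induction_on with
  | empty => simp
  | insert i s hi ih =>
    rw [Finset.sup_insert, Finset.sum_insert hi]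
    exact (Submodule.finrank_add_le_finrank_add_finrank _ _).trans (Nat.add_le_add_left ih _)

theorem finrank_fibreSpan_le {a b c : ℕ} (A : Fin a → Fin b → Fin c → ℝ) :
    Module.finrank ℂ (fibreSpan A) ≤ c * tubalRank A := by
  let W : Fin c → Submodule ℂ (Fin a → ℂ) := fun k =>
    Submodule.span ℂ (Set.range (fourierSlice A k).col)
  have hle : fibreSpan A ≤ Finset.univ.sup W := by
    refine Submodule.span_le.2 ?_
    rintro _ ⟨⟨j, l⟩, rfl⟩
    have h : (fun i => (A i j l : ℂ)) =
        ∑ k, (fourierMatrix c)⁻¹ l k • (fourierSlice A k).col j := by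
      ext i
      simp [fourierInversion A i j l]
    change (fun i => (A i j l : ℂ)) ∈ Finset.univ.sup W
    rw [h]
    exact Submodule.sum_mem _ fun k _ => Submodule.smul_mem _ _
      (Finset.le_sup (f := W) (Finset.mem_univ k) (Submodule.subset_span ⟨j, rfl⟩))
  calc Module.finrank ℂ (fibreSpan A)
      ≤ Module.finrank ℂ (Finset.univ.sup W : Submodule ℂ (Fin a → ℂ)) :=
        Submodule.finrank_mono hle
    _ ≤ ∑ k, Module.finrank ℂ (W k) := finrank_finset_sup_le_sum _ _
    _ ≤ ∑ _k : Fin c, tubalRank A := Finset.sum_le_sum fun k _ => by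
        rw [← Matrix.rank_eq_finrank_span_cols]
        exact Finset.le_sup (f := fun k => (fourierSlice A k).rank) (Finset.mem_univ k)
    _ = c * tubalRank A := by simp

theorem tubalRank_swap_s12 {a b c : ℕ} (A : Fin a → Fin b → Fin c → ℝ) :
    tubalRank (fun j i l => A i j l) = tubalRank A := by
  refine Finset.sup_congr rfl fun k _ => ?_
  rw [← Matrix.rank_transpose (fourierSlice A k)]
  rfl

theorem exists_colIdx_eq {a b : ℕ} (x : Fin (a * b)) :
    ∃ (j : Fin a) (k : Fin b), colIdx j k = x := by
  have ha : 0 < a := Nat.pos_of_mul_pos_right (x.pos)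
  refine ⟨⟨x % a, Nat.mod_lt _ ha⟩, ⟨x / a, Nat.div_lt_of_lt_mul x.isLt⟩, Fin.ext ?_⟩
  exact Nat.div_add_mod' (x : ℕ) a

/-- with `X_{(3)} ∈ ℝ^{n3×n1n2}` the mode-3 unfolding of
`𝒳 ∈ ℝ^{n1×n2×n3}`, `pq = n1n2`, `𝒳̃ ∈ ℝ^{n3×p×q}` the reshape of `X_{(3)}`
(`𝒳̃(a,s,t) = X_{(3)}(a, (t−1)p + s)`), and `𝒳_{(23)} ∈ ℝ^{n2×n3×n1}` the permuted
tensor (`𝒳_{(23)}(j,k,i) = 𝒳(i,j,k)`), one has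
`rank_t(𝒳̃) ≤ n1 · rank_t(𝒳_{(23)})` and `rank_t(𝒳_{(23)}) ≤ q · rank_t(𝒳̃)`. -/
theorem tubalRank_tilde_perm23_bounds (n1 n2 n3 p q : ℕ)
    (hp : 0 < p) (hq : 0 < q) (hpq : p * q = n1 * n2)
    (T : Fin n1 → Fin n2 → Fin n3 → ℝ)
    (X3 : Matrix (Fin n3) (Fin (n1 * n2)) ℝ)
    (hX3 : ∀ (i1 : Fin n1) (i2 : Fin n2) (i3 : Fin n3),
      X3 i3 (colIdx i1 i2) = T i1 i2 i3)
    (Ttil : Fin n3 → Fin p → Fin q → ℝ)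
    (hTtil : ∀ (a : Fin n3) (s : Fin p) (t : Fin q),
      Ttil a s t = X3 a (Fin.cast hpq (colIdx s t)))
    (T23 : Fin n2 → Fin n3 → Fin n1 → ℝ)
    (hT23 : ∀ (i : Fin n1) (j : Fin n2) (k : Fin n3), T23 j k i = T i j k) :
    tubalRank Ttil ≤ n1 * tubalRank T23 ∧ tubalRank T23 ≤ q * tubalRank Ttil := by
  have hspan : fibreSpan Ttil = fibreSpan (fun k j i => T23 j k i) := by
    unfold fibreSpan
    congr 1
    ext v
    constructor
    · rintro ⟨⟨s, t⟩, rfl⟩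
      obtain ⟨i, j, hij⟩ := exists_colIdx_eq (Fin.cast hpq (colIdx s t))
      exact ⟨(j, i), funext fun k => by simp only [hTtil, ← hij, hX3, hT23]⟩
    · rintro ⟨⟨j, i⟩, rfl⟩
      obtain ⟨s, t, hst⟩ := exists_colIdx_eq (Fin.cast hpq.symm (colIdx i j))
      exact ⟨(s, t), funext fun k => by simp [hTtil, hst, hX3, hT23]⟩
  rw [← tubalRank_swap_s12 T23]
  exact ⟨(tubalRank_le_finrank_fibreSpan _).trans (hspan ▸ finrank_fibreSpan_le _),
    (tubalRank_le_finrank_fibreSpan _).trans (hspan ▸ finrank_fibreSpan_le _)⟩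
end

section
/- Let γ > 0, let M ∈ ℂ^{m×n}, Ω ⊆ [m]×[n], and X ∈ ℂ^{m×n} with P_Ω(X − M) = 0. Let β : [m]×[n] → [m']×[n'] be a bijection (m'n' = mn) and let ρ : ℂ^{m×n} → ℂ^{m'×n'} be the induced entry rearrangement, ρ(Z)(β(i,j)) = Z(i,j), and set Y = ρ(X). Let P, P' ∈ ℂ^{m×r}, Q, Q' ∈ ℂ^{r×n} satisfy (P'Q − X)Q* = 0, (P')*(P'Q' − X) = 0, P'(Q − Q')Q* = 0, and let U, U' ∈ ℂ^{m'×s}, V, V' ∈ ℂ^{s×n'} satisfy (U'V − Y)V* = 0, (U')*(U'V' − Y) = 0, U'(V − V')V* = 0. Set X' = (1/(1+γ)) P_{Ω^c}(P'Q' + γ ρ^{−1}(U'V')) + P_Ω(M). Then for f(P,Q,U,V,X) = ½‖PQ − X‖_F² + (γ/2)‖UV − ρ(X)‖_F², one has f(P,Q,U,V,X) − f(P',Q',U',V',X') ≥ ½‖P'Q' − PQ‖_F² + (γ/2)‖U'V' − UV‖_F² ≥ 0. -/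
open Matrix

/-- `P_Ω(X)`: the matrix agreeing with `X` on the entries indexed by `Ω` and zero
elsewhere. -/
def projOn {m n : ℕ} (Ω : Finset (Fin m × Fin n)) (X : Matrix (Fin m) (Fin n) ℂ) :
    Matrix (Fin m) (Fin n) ℂ :=
  Matrix.of fun i j => if (i, j) ∈ Ω then X i j else 0

/-- Squared Frobenius norm `‖A‖_F² = Σ_{i,j} |A_{ij}|²`. -/
noncomputable def frobSq {m n : ℕ} (A : Matrix (Fin m) (Fin n) ℂ) : ℝ :=
  ∑ i : Fin m, ∑ j : Fin n, Complex.normSq (A i j)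

/-- The entry rearrangement `ρ : ℂ^{m×n} → ℂ^{m'×n'}` induced by a bijection
`β : [m]×[n] ≃ [m']×[n']`: `ρ(Z)(β(i,j)) = Z(i,j)`. -/
def rearr {m n m' n' : ℕ} (e : Fin m × Fin n ≃ Fin m' × Fin n')
    (Z : Matrix (Fin m) (Fin n) ℂ) : Matrix (Fin m') (Fin n') ℂ :=
  Matrix.of fun i j => Z (e.symm (i, j)).1 (e.symm (i, j)).2

lemma frobSq_nonneg {m n : ℕ} (A : Matrix (Fin m) (Fin n) ℂ) : 0 ≤ frobSq A :=
  Finset.sum_nonneg fun _ _ => Finset.sum_nonneg fun _ _ => Complex.normSq_nonneg _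

lemma frobSq_eq_re_trace {m n : ℕ} (A : Matrix (Fin m) (Fin n) ℂ) :
    frobSq A = (trace (Aᴴ * A)).re := by
  simp only [frobSq, trace, diag_apply, mul_apply, conjTranspose_apply, Complex.re_sum]
  rw [Finset.sum_comm]
  refine Finset.sum_congr rfl fun _ _ => Finset.sum_congr rfl fun _ _ => ?_
  simp [Complex.normSq_apply]

lemma frobSq_sub_of_trace_eq_zero {m n : ℕ} {A B : Matrix (Fin m) (Fin n) ℂ}
    (h : trace (Aᴴ * B) = 0) : frobSq (B - A) = frobSq A + frobSq B := by
  have h' : trace (Bᴴ * A) = 0 := by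
    rw [← conjTranspose_conjTranspose A, ← conjTranspose_mul, trace_conjTranspose, h, star_zero]
  simp only [frobSq_eq_re_trace, conjTranspose_sub, Matrix.sub_mul, Matrix.mul_sub, trace_sub,
    h, h', Complex.sub_re, Complex.zero_re]
  ring

/-- Pythagorean identity for one alternating least-squares update. -/
lemma frobSq_als_update {m n r : ℕ} {X : Matrix (Fin m) (Fin n) ℂ}
    {P P' : Matrix (Fin m) (Fin r) ℂ} {Q Q' : Matrix (Fin r) (Fin n) ℂ}
    (h1 : (P' * Q - X) * Qᴴ = 0) (h2 : P'ᴴ * (P' * Q' - X) = 0)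
    (h3 : P' * (Q - Q') * Qᴴ = 0) :
    frobSq (P * Q - X) = frobSq (P' * Q' - P * Q) + frobSq (P' * Q' - X) := by
  have hQ : (P' * Q' - X) * Qᴴ = 0 := by
    have : P' * Q' - X = (P' * Q - X) - P' * (Q - Q') := by
      rw [Matrix.mul_sub]; abel
    rw [this, Matrix.sub_mul, h1, h3, sub_zero]
  have hP : trace ((P' * Q')ᴴ * (P' * Q' - X)) = 0 := by
    rw [conjTranspose_mul, Matrix.mul_assoc, h2, Matrix.mul_zero, trace_zero]
  have hPQ : trace ((P * Q)ᴴ * (P' * Q' - X)) = 0 := by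
    rw [conjTranspose_mul, Matrix.mul_assoc, trace_mul_comm, Matrix.mul_assoc, hQ,
      Matrix.mul_zero, trace_zero]
  rw [← frobSq_sub_of_trace_eq_zero (by
    rw [conjTranspose_sub, Matrix.sub_mul, trace_sub, hP, hPQ, sub_zero])]
  congr 1
  abel

lemma frobSq_sub_rearr {m n m' n' : ℕ} (e : Fin m × Fin n ≃ Fin m' × Fin n')
    (W : Matrix (Fin m') (Fin n') ℂ) (Z : Matrix (Fin m) (Fin n) ℂ) :
    frobSq (W - rearr e Z) = frobSq (rearr e.symm W - Z) := by
  simp only [frobSq, ← Fintype.sum_prod_type']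
  refine Fintype.sum_equiv e.symm _ _ fun p => ?_
  simp [rearr]

/-- The weighted mean `(a + γ b) / (1 + γ)` minimizes `|a - x|² + γ |b - x|²`. -/
lemma normSq_weightedMean_le {γ : ℝ} (hγ : 0 < γ) (a b x : ℂ) :
    Complex.normSq (a - ((1 / (1 + γ) : ℝ) : ℂ) * (a + γ * b)) +
        γ * Complex.normSq (b - ((1 / (1 + γ) : ℝ) : ℂ) * (a + γ * b)) ≤
      Complex.normSq (a - x) + γ * Complex.normSq (b - x) := by
  have hγ' : 1 + γ ≠ 0 := by positivity
  have key : Complex.normSq (a - x) + γ * Complex.normSq (b - x) =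
      Complex.normSq (a - ((1 / (1 + γ) : ℝ) : ℂ) * (a + γ * b)) +
        γ * Complex.normSq (b - ((1 / (1 + γ) : ℝ) : ℂ) * (a + γ * b)) +
        (1 + γ) * Complex.normSq (x - ((1 / (1 + γ) : ℝ) : ℂ) * (a + γ * b)) := by
    simp only [Complex.normSq_apply, Complex.sub_re, Complex.sub_im, Complex.add_re,
      Complex.add_im, Complex.re_ofReal_mul, Complex.im_ofReal_mul]
    field_simp
    ring
  rw [key]
  exact le_add_of_nonneg_right (mul_nonneg (by positivity) (Complex.normSq_nonneg _))

/-- The completion step does not increase the weighted misfit to `A` and `B`. -/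
lemma frobSq_completion_le {m n : ℕ} {γ : ℝ} (hγ : 0 < γ) {Ω : Finset (Fin m × Fin n)}
    {M X : Matrix (Fin m) (Fin n) ℂ} (hX : projOn Ω (X - M) = 0)
    (A B : Matrix (Fin m) (Fin n) ℂ) {X' : Matrix (Fin m) (Fin n) ℂ}
    (hX' : X' = ((1 / (1 + γ) : ℝ) : ℂ) • projOn Ωᶜ (A + (γ : ℂ) • B) + projOn Ω M) :
    frobSq (A - X') + γ * frobSq (B - X') ≤ frobSq (A - X) + γ * frobSq (B - X) := by
  simp only [frobSq, Finset.mul_sum, ← Finset.sum_add_distrib]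
  refine Finset.sum_le_sum fun i _ => Finset.sum_le_sum fun j _ => ?_
  by_cases hij : (i, j) ∈ Ω
  · have hXM : X i j = M i j := by
      have := congrFun (congrFun hX i) j
      simpa [projOn, hij, sub_eq_zero] using this
    have hX'M : X' i j = M i j := by simp [hX', projOn, hij]
    simp only [Matrix.sub_apply, hXM, hX'M, le_refl]
  · have hmean : X' i j = ((1 / (1 + γ) : ℝ) : ℂ) * (A i j + γ * B i j) := by
      simp [hX', projOn, hij]
    simpa only [Matrix.sub_apply, hmean] using normSq_weightedMean_le hγ (A i j) (B i j) (X i j)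

/-- the matrix form of the DTRTC descent inequality. With
`P_Ω(X − M) = 0`, `Y = ρ(X)`, ALS normal equations for `(P,Q,P',Q')` w.r.t. `X` and
for `(U,V,U',V')` w.r.t. `Y`, and
`X' = (1/(1+γ)) P_{Ω^c}(P'Q' + γ ρ⁻¹(U'V')) + P_Ω(M)`, the objective
`f(P,Q,U,V,X) = ½‖PQ − X‖_F² + (γ/2)‖UV − ρ(X)‖_F²` decreases:
`f(P,Q,U,V,X) − f(P',Q',U',V',X') ≥ ½‖P'Q' − PQ‖_F² + (γ/2)‖U'V' − UV‖_F² ≥ 0`. -/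
theorem dtrtc_objective_decrease (m n m' n' r s : ℕ) (hdim : m' * n' = m * n)
    (γ : ℝ) (hγ : 0 < γ)
    (e : Fin m × Fin n ≃ Fin m' × Fin n')
    (M : Matrix (Fin m) (Fin n) ℂ) (Ω : Finset (Fin m × Fin n))
    (X : Matrix (Fin m) (Fin n) ℂ) (hX : projOn Ω (X - M) = 0)
    (Y : Matrix (Fin m') (Fin n') ℂ) (hY : Y = rearr e X)
    (P P' : Matrix (Fin m) (Fin r) ℂ) (Q Q' : Matrix (Fin r) (Fin n) ℂ)
    (h1 : (P' * Q - X) * Qᴴ = 0)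
    (h2 : P'ᴴ * (P' * Q' - X) = 0)
    (h3 : P' * (Q - Q') * Qᴴ = 0)
    (U U' : Matrix (Fin m') (Fin s) ℂ) (V V' : Matrix (Fin s) (Fin n') ℂ)
    (h4 : (U' * V - Y) * Vᴴ = 0)
    (h5 : U'ᴴ * (U' * V' - Y) = 0)
    (h6 : U' * (V - V') * Vᴴ = 0)
    (X' : Matrix (Fin m) (Fin n) ℂ)
    (hX' : X' = ((1 / (1 + γ) : ℝ) : ℂ) •
        projOn Ωᶜ (P' * Q' + (γ : ℂ) • rearr e.symm (U' * V')) + projOn Ω M) :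
    (1 / 2 : ℝ) * frobSq (P' * Q' - P * Q) + (γ / 2) * frobSq (U' * V' - U * V) ≤
        ((1 / 2 : ℝ) * frobSq (P * Q - X) + (γ / 2) * frobSq (U * V - rearr e X)) -
          ((1 / 2 : ℝ) * frobSq (P' * Q' - X') +
            (γ / 2) * frobSq (U' * V' - rearr e X')) ∧
      (0 : ℝ) ≤ (1 / 2 : ℝ) * frobSq (P' * Q' - P * Q) +
        (γ / 2) * frobSq (U' * V' - U * V) := by
  subst hY
  have hPQ := frobSq_als_update (P := P) h1 h2 h3
  have hUV := frobSq_als_update (P := U) h4 h5 h6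
  have hstep := frobSq_completion_le hγ hX _ _ hX'
  rw [← frobSq_sub_rearr, ← frobSq_sub_rearr] at hstep
  refine ⟨?_, add_nonneg (mul_nonneg (by norm_num) (frobSq_nonneg _))
    (mul_nonneg (by positivity) (frobSq_nonneg _))⟩
  rw [hPQ, hUV]
  linarith
end
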